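/- For n ≥ 2: (i) every pair {p,q} of distinct states of Q_n \ {0, n−1} is colliding in Vsf(n); and (ii) if T ⊆ Bsf(n) is closed under composition and every pair of distinct states of Q_n \ {0, n−1} is colliding in T, then T ⊆ Vsf(n). Thus Vsf(n) is the unique maximal transition semigroup of a suffix-free language in which all possible pairs of states are colliding. -/

import Mathlib

/-- `Bsf n`: transformations `t` of `Q_n = {0,…,n-1}` such that `0` is not in the range
of `t`, `(n-1)t = n-1`, and for every `j ≥ 1` either `0t^j = n-1` or `0t^j ≠ qt^j`
for all `q` with `0 < q < n-1`. -/
def Bsf (n : ℕ) (hn : 0 < n) : Set (Fin n → Fin n) :=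
  {t | (∀ q : Fin n, t q ≠ ⟨0, hn⟩) ∧ t ⟨n - 1, by omega⟩ = ⟨n - 1, by omega⟩ ∧
    ∀ j : ℕ, 1 ≤ j →
      (t^[j] ⟨0, hn⟩ = ⟨n - 1, by omega⟩ ∨
        ∀ q : Fin n, 0 < q.val → q.val < n - 1 → t^[j] ⟨0, hn⟩ ≠ t^[j] q)}

/-- `Vsf n`: members of `Bsf n` such that any two distinct states are either both
mapped to `n-1` or mapped to distinct states. -/
def Vsf (n : ℕ) (hn : 0 < n) : Set (Fin n → Fin n) :=
  {t | t ∈ Bsf n hn ∧ ∀ p q : Fin n, p ≠ q →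
    (t p = ⟨n - 1, by omega⟩ ∧ t q = ⟨n - 1, by omega⟩) ∨ t p ≠ t q}

/-- `Wsf n`: members of `Bsf n` that either map `0` to `n-1` or map every
`q` with `1 ≤ q ≤ n-2` to `n-1`. -/
def Wsf (n : ℕ) (hn : 0 < n) : Set (Fin n → Fin n) :=
  {t | t ∈ Bsf n hn ∧ (t ⟨0, hn⟩ = ⟨n - 1, by omega⟩ ∨
    ∀ q : Fin n, 1 ≤ q.val → q.val ≤ n - 2 → t q = ⟨n - 1, by omega⟩)}

/-- The (unordered) pair `{p,q}` of distinct states of `Q_n \ {0, n-1}` is colliding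
in the set `T` of transformations. -/
def Colliding {n : ℕ} (hn : 0 < n) (T : Set (Fin n → Fin n)) (p q : Fin n) : Prop :=
  ∃ t ∈ T, ∃ r : Fin n, 0 < r.val ∧ r.val < n - 1 ∧
    ((t ⟨0, hn⟩ = p ∧ t r = q) ∨ (t ⟨0, hn⟩ = q ∧ t r = p))

/-- The semigroup of transformations generated by `G` under composition:
the least set containing `G` and closed under composition. -/
def genSG {β : Type} (G : Set (β → β)) : Set (β → β) :=
  ⋂₀ {T : Set (β → β) | G ⊆ T ∧ ∀ f ∈ T, ∀ g ∈ T, (g ∘ f) ∈ T}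

/-- For `n ≥ 2`: (i) every pair of distinct states of `Q_n \ {0, n−1}` is colliding
in `Vsf(n)`; (ii) if `T ⊆ Bsf(n)` is closed under composition and every pair of
distinct states of `Q_n \ {0, n−1}` is colliding in `T`, then `T ⊆ Vsf(n)`. -/
theorem stmt4 (n : ℕ) (hn : 2 ≤ n) :
    (∀ p q : Fin n, 0 < p.val → p.val < n - 1 → 0 < q.val → q.val < n - 1 → p ≠ q →
      Colliding (by omega) (Vsf n (by omega)) p q) ∧
    (∀ T : Set (Fin n → Fin n), T ⊆ Bsf n (by omega) →
      (∀ s ∈ T, ∀ t ∈ T, (t ∘ s) ∈ T) →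
      (∀ p q : Fin n, 0 < p.val → p.val < n - 1 → 0 < q.val → q.val < n - 1 → p ≠ q →
        Colliding (by omega) T p q) →
      T ⊆ Vsf n (by omega)) := by
  constructor
  · intro p q hp hp' hq hq' hpq
    have hl : (⟨n - 1, by omega⟩ : Fin n) ≠ ⟨0, by omega⟩ := by simp [Fin.ext_iff]; omega
    have hp0 : p ≠ ⟨0, by omega⟩ := by simp [Fin.ext_iff]; omega
    have hq0 : q ≠ ⟨0, by omega⟩ := by simp [Fin.ext_iff]; omega
    have hpl : p ≠ ⟨n - 1, by omega⟩ := by simp [Fin.ext_iff]; omega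
    have hql : q ≠ ⟨n - 1, by omega⟩ := by simp [Fin.ext_iff]; omega
    let t : Fin n → Fin n := fun x =>
      if x = ⟨0, by omega⟩ then p else if x = q then q else ⟨n - 1, by omega⟩
    have ht : ∀ x, t x = if x = ⟨0, by omega⟩ then p else if x = q then q
      else ⟨n - 1, by omega⟩ := fun _ => rfl
    have htl : t ⟨n - 1, by omega⟩ = ⟨n - 1, by omega⟩ := by grind
    have ht0 : t ⟨0, by omega⟩ = p := by grind
    have htp : t p = ⟨n - 1, by omega⟩ := by grind
    refine ⟨t, ⟨⟨?_, htl, ?_⟩, ?_⟩, q, hq, hq', Or.inl ⟨ht0, by grind⟩⟩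
    · intro x; grind
    · intro j hj
      obtain ⟨k, rfl⟩ : ∃ k, j = k + 1 := ⟨j - 1, by omega⟩
      rcases k with _ | k
      · right
        intro x hx hx'
        have hx0 : x ≠ ⟨0, by omega⟩ := by simp [Fin.ext_iff]; omega
        simp only [zero_add, Function.iterate_one]
        grind
      · left
        rw [Function.iterate_succ_apply, Function.iterate_succ_apply, ht0, htp]
        exact Function.iterate_fixed htl k
    · intro x y hxy; grind
  · intro T hT hc hcol t htT
    have hB := hT htT
    refine ⟨hB, ?_⟩
    intro p q hpq
    by_contra hcon
    push Not at hcon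
    obtain ⟨h1, h2⟩ := hcon
    have hpne : t p ≠ ⟨n - 1, by omega⟩ := fun h => h1 h (h2 ▸ h)
    have hqne : t q ≠ ⟨n - 1, by omega⟩ := h2 ▸ hpne
    have key : ∀ x : Fin n, t x ≠ ⟨n - 1, by omega⟩ → x.val < n - 1 := by
      intro x hx
      have : x.val ≠ n - 1 := by
        intro h
        apply hx
        have hx' : x = ⟨n - 1, by omega⟩ := Fin.ext h
        rw [hx']; exact hB.2.1
      have := x.2
      omega
    have hpl := key p hpne
    have hql := key q hqne
    have zero : ∀ u ∈ T, ∀ x : Fin n, 0 < x.val → x.val < n - 1 →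
        u ⟨0, by omega⟩ ≠ ⟨n - 1, by omega⟩ → u ⟨0, by omega⟩ ≠ u x := by
      intro u hu x hx hx' hne
      rcases (hT hu).2.2 1 le_rfl with h | h
      · exact absurd h hne
      · exact h x hx hx'
    have hv : p.val ≠ q.val := fun h => hpq (Fin.ext h)
    rcases Nat.eq_zero_or_pos p.val with hp | hp
    · have hp' : p = ⟨0, by omega⟩ := Fin.ext hp
      rw [hp'] at h2 hpne
      exact zero t htT q (by omega) hql hpne h2
    rcases Nat.eq_zero_or_pos q.val with hq | hq
    · have hq' : q = ⟨0, by omega⟩ := Fin.ext hq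
      rw [hq'] at h2 hqne
      exact zero t htT p hp hpl hqne h2.symm
    obtain ⟨s, hs, r, hr, hr', ⟨ha, hb⟩ | ⟨ha, hb⟩⟩ := hcol p q hp hpl hq hql hpq
    · exact zero _ (hc s hs t htT) r hr hr' (by simpa [ha] using hpne) (by simp [ha, hb, h2])
    · exact zero _ (hc s hs t htT) r hr hr' (by simpa [ha] using hqne) (by simp [ha, hb, h2])
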